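/- (Closed equation on the balanced variety, Arora–Cohen–Hazan.) Let E : M_d → ℝ be C¹ and let 𝐖 : I → M_d^N be a differentiable solution of the DLN gradient flow Ẇ_p = −(W_N⋯W_{p+1})ᵀ E'(W) (W_{p−1}⋯W_1)ᵀ, p = 1,…,N, such that 𝐖(t) is balanced for every t ∈ I (by the conservation of the balancedness constraints it suffices that 𝐖 is balanced at one time). Then the end-to-end matrix W(t) = W_N(t)⋯W_1(t) satisfies Ẇ = −∑_{k=1}^N (WWᵀ)^{(N−k)/N} E'(W) (WᵀW)^{(k−1)/N}, where the fractional powers of the positive semidefinite matrices WWᵀ and WᵀW are defined via the spectral decomposition. -/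

import Mathlib

open Matrix BigOperators

attribute [local instance] Matrix.normedAddCommGroup Matrix.normedSpace

noncomputable def mpow {d : ℕ} (P : Matrix (Fin d) (Fin d) ℝ) (s : ℝ) :
    Matrix (Fin d) (Fin d) ℝ :=
  if h : P.IsHermitian then
    (h.eigenvectorUnitary : Matrix (Fin d) (Fin d) ℝ) *
      Matrix.diagonal (fun i => (h.eigenvalues i) ^ s) *
      star (h.eigenvectorUnitary : Matrix (Fin d) (Fin d) ℝ)
  else 0

def Bprod {d : ℕ} (W : ℕ → Matrix (Fin d) (Fin d) ℝ) (p : ℕ) : Matrix (Fin d) (Fin d) ℝ :=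
  ((List.range p).map (fun i => W (p - i))).prod

def Aprod {d : ℕ} (W : ℕ → Matrix (Fin d) (Fin d) ℝ) (N p : ℕ) : Matrix (Fin d) (Fin d) ℝ :=
  ((List.range (N + 1 - p)).map (fun i => W (N - i))).prod

def BalancedTuple {d : ℕ} (N : ℕ) (W : ℕ → Matrix (Fin d) (Fin d) ℝ) : Prop :=
  ∀ p, 1 ≤ p → p < N → (W (p+1))ᵀ * W (p+1) = W p * (W p)ᵀ

noncomputable def frobCLM {d : ℕ} (G : Matrix (Fin d) (Fin d) ℝ) :
    Matrix (Fin d) (Fin d) ℝ →L[ℝ] ℝ :=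
  LinearMap.toContinuousLinearMap
    { toFun := fun Z => (Gᵀ * Z).trace
      map_add' := fun x y => by simp [Matrix.mul_add]
      map_smul' := fun c x => by simp [Matrix.mul_smul] }


theorem mpow_pow_div {d : ℕ} {P : Matrix (Fin d) (Fin d) ℝ} (hP : P.PosSemidef)
    {N : ℕ} (hN : N ≠ 0) (m : ℕ) : mpow (P ^ N) ((m : ℝ) / N) = P ^ m := by
  have hNP : (P ^ N).IsHermitian := hP.1.pow N
  have hcfc : mpow (P ^ N) ((m : ℝ) / N) = cfc (fun x : ℝ => x ^ ((m : ℝ) / N)) (P ^ N) := by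
    rw [hNP.cfc_eq, Matrix.IsHermitian.cfc, Unitary.conjStarAlgAut_apply, mpow, dif_pos hNP]
    rfl
  have hcont : Continuous fun x : ℝ => x ^ ((m : ℝ) / N) :=
    Real.continuous_rpow_const (by positivity)
  have hsa : IsSelfAdjoint P := hP.1
  rw [hcfc, ← cfc_comp_pow _ N P hcont.continuousOn hsa, ← cfc_pow_id (R := ℝ) P m hsa]
  refine cfc_congr fun x hx => ?_
  have hx0 : 0 ≤ x := (posSemidef_iff_isHermitian_and_spectrum_nonneg.1 hP).2 hx
  have hN' : (N : ℝ) ≠ 0 := Nat.cast_ne_zero.2 hN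
  rw [← Real.rpow_natCast x N, ← Real.rpow_mul hx0, mul_div_cancel₀ _ hN', Real.rpow_natCast]

theorem Bprod_zero {d : ℕ} (W : ℕ → Matrix (Fin d) (Fin d) ℝ) : Bprod W 0 = 1 := rfl

theorem Bprod_succ {d : ℕ} (W : ℕ → Matrix (Fin d) (Fin d) ℝ) (p : ℕ) :
    Bprod W (p + 1) = W (p + 1) * Bprod W p := by
  simp [Bprod, List.range_succ_eq_map, List.map_map, Function.comp_def]

theorem Aprod_self_add_one {d : ℕ} (W : ℕ → Matrix (Fin d) (Fin d) ℝ) (N : ℕ) :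
    Aprod W N (N + 1) = 1 := by
  simp [Aprod]

theorem Aprod_succ {d : ℕ} (W : ℕ → Matrix (Fin d) (Fin d) ℝ) {N p : ℕ} (hp : p ≤ N + 1) :
    Aprod W (N + 1) p = W (N + 1) * Aprod W N p := by
  rw [Aprod, Aprod, Nat.succ_sub hp]
  simp [List.range_succ_eq_map, List.map_map, Function.comp_def]

theorem Bprod_eq_Aprod_one {d : ℕ} (W : ℕ → Matrix (Fin d) (Fin d) ℝ) (N : ℕ) :
    Bprod W N = Aprod W N 1 := by
  simp [Bprod, Aprod]

theorem mul_pow_transpose_mul {d : ℕ} (A : Matrix (Fin d) (Fin d) ℝ) (m : ℕ) :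
    A * (Aᵀ * A) ^ m * Aᵀ = (A * Aᵀ) ^ (m + 1) := by
  induction m with
  | zero => simp
  | succ m ih =>
    rw [pow_succ' (A * Aᵀ), ← ih, pow_succ']
    simp only [Matrix.mul_assoc]

namespace BalancedTuple

theorem mono {d M N : ℕ} {W : ℕ → Matrix (Fin d) (Fin d) ℝ} (h : BalancedTuple N W)
    (hMN : M ≤ N) : BalancedTuple M W :=
  fun p hp hpM => h p hp (hpM.trans_le hMN)

theorem Aprod_mul_transpose {d N : ℕ} {W : ℕ → Matrix (Fin d) (Fin d) ℝ}
    (h : BalancedTuple N W) {p : ℕ} (hp : 1 ≤ p) (hpN : p ≤ N + 1) :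
    Aprod W N p * (Aprod W N p)ᵀ = (W N * (W N)ᵀ) ^ (N + 1 - p) := by
  induction N with
  | zero =>
    obtain rfl : p = 0 + 1 := le_antisymm hpN hp
    simp [Aprod_self_add_one]
  | succ N ih =>
    rcases hpN.eq_or_lt with rfl | hlt
    · simp [Aprod_self_add_one]
    have hpN' : p ≤ N + 1 := Nat.lt_succ_iff.1 hlt
    rw [Aprod_succ W hpN', Nat.succ_sub hpN', ← mul_pow_transpose_mul, Matrix.transpose_mul]
    have key : Aprod W N p * (Aprod W N p)ᵀ
        = ((W (N + 1))ᵀ * W (N + 1)) ^ (N + 1 - p) := by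
      rw [ih (h.mono N.le_succ) hpN']
      rcases N.eq_zero_or_pos with rfl | hN
      · simp [show 0 + 1 - p = 0 by omega]
      · rw [h N hN N.lt_succ_self]
    rw [← key]
    simp only [Matrix.mul_assoc]

theorem transpose_mul_Bprod {d N : ℕ} {W : ℕ → Matrix (Fin d) (Fin d) ℝ}
    (h : BalancedTuple N W) {p : ℕ} (hp : p ≤ N) :
    (Bprod W p)ᵀ * Bprod W p = ((W 1)ᵀ * W 1) ^ p := by
  have hpow : ∀ q, q < N → ∀ m, (Bprod W q)ᵀ * ((W (q + 1))ᵀ * W (q + 1)) ^ m * Bprod W q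
      = ((W 1)ᵀ * W 1) ^ (m + q) := by
    intro q
    induction q with
    | zero => simp [Bprod_zero]
    | succ q ih =>
      intro hq m
      rw [h (q + 1) q.succ_pos hq, Bprod_succ, Matrix.transpose_mul,
        show m + (q + 1) = m + 1 + q by omega, ← ih (by omega)]
      have := mul_pow_transpose_mul (W (q + 1))ᵀ m
      rw [Matrix.transpose_transpose] at this
      rw [← this]
      simp only [Matrix.mul_assoc]
  cases p with
  | zero => simp [Bprod_zero]
  | succ p =>
    have := hpow p hp 1
    rw [add_comm 1 p, pow_one] at this
    rw [← this, Bprod_succ, Matrix.transpose_mul]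
    simp only [Matrix.mul_assoc]

end BalancedTuple

theorem HasDerivAt.matrix_mul {l m n : Type*} [Fintype l] [Fintype m] [Fintype n]
    {A : ℝ → Matrix l m ℝ} {B : ℝ → Matrix m n ℝ} {A' : Matrix l m ℝ} {B' : Matrix m n ℝ} {t : ℝ}
    (hA : HasDerivAt A A' t) (hB : HasDerivAt B B' t) :
    HasDerivAt (fun τ => A τ * B τ) (A' * B t + A t * B') t := by
  refine hasDerivAt_pi.2 fun i => hasDerivAt_pi.2 fun j => ?_
  have hA' := fun k => hasDerivAt_pi.1 (hasDerivAt_pi.1 hA i) k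
  have hB' := fun k => hasDerivAt_pi.1 (hasDerivAt_pi.1 hB k) j
  have := HasDerivAt.fun_sum (u := Finset.univ) fun k _ => (hA' k).mul (hB' k)
  rw [Finset.sum_add_distrib] at this
  exact this

theorem hasDerivAt_Bprod {d : ℕ} {W : ℕ → ℝ → Matrix (Fin d) (Fin d) ℝ}
    {W' : ℕ → Matrix (Fin d) (Fin d) ℝ} {t : ℝ} (N : ℕ)
    (hW : ∀ p, 1 ≤ p → p ≤ N → HasDerivAt (W p) (W' p) t) :
    HasDerivAt (fun τ => Bprod (fun q => W q τ) N)
      (∑ k ∈ Finset.Icc 1 N,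
        Aprod (fun q => W q t) N (k + 1) * W' k * Bprod (fun q => W q t) (k - 1)) t := by
  induction N with
  | zero => exact hasDerivAt_const t (1 : Matrix (Fin d) (Fin d) ℝ)
  | succ N ih =>
    have hmul := (hW (N + 1) N.succ_pos le_rfl).matrix_mul
      (ih fun p hp hpN => hW p hp (hpN.trans N.le_succ))
    simp only [Bprod_succ]
    convert hmul using 1
    rw [Finset.sum_Icc_succ_top N.succ_pos, Aprod_self_add_one, Matrix.one_mul,
      Nat.add_sub_cancel, add_comm, Matrix.mul_sum]
    congr 1
    refine Finset.sum_congr rfl fun k hk => ?_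
    rw [Aprod_succ _ (Nat.succ_le_succ (Finset.mem_Icc.1 hk).2)]
    simp only [Matrix.mul_assoc]

/-- **Arora–Cohen–Hazan: closed equation on the balanced variety.**
If a solution of the DLN gradient flow is balanced, then the end-to-end matrix
satisfies `Ẇ = −∑_{k=1}^N (WWᵀ)^{(N−k)/N} E'(W) (WᵀW)^{(k−1)/N}`, where
fractional powers of positive semidefinite matrices are taken via the spectral
decomposition (the function `mpow`). -/
theorem dln_closed_balanced {d N : ℕ} (hN : 1 ≤ N)
    (E : Matrix (Fin d) (Fin d) ℝ → ℝ)
    (G : Matrix (Fin d) (Fin d) ℝ → Matrix (Fin d) (Fin d) ℝ)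
    (hE : ∀ X, HasFDerivAt E (frobCLM (G X)) X) (hG : Continuous G)
    (I : Set ℝ) (hI : Convex ℝ I)
    (W : ℕ → ℝ → Matrix (Fin d) (Fin d) ℝ)
    (hflow : ∀ p, 1 ≤ p → p ≤ N → ∀ t ∈ I,
      HasDerivAt (W p)
        (-((Aprod (fun q => W q t) N (p + 1))ᵀ * G (Bprod (fun q => W q t) N) *
            (Bprod (fun q => W q t) (p - 1))ᵀ)) t)
    (hbal : ∀ t ∈ I, BalancedTuple N (fun q => W q t)) :
    ∀ t ∈ I,
      HasDerivAt (fun τ => Bprod (fun q => W q τ) N)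
        (-(∑ k ∈ Finset.Icc 1 N,
            mpow (Bprod (fun q => W q t) N * (Bprod (fun q => W q t) N)ᵀ)
                (((N : ℝ) - k) / N) *
              G (Bprod (fun q => W q t) N) *
              mpow ((Bprod (fun q => W q t) N)ᵀ * Bprod (fun q => W q t) N)
                (((k : ℝ) - 1) / N))) t := by
  intro t ht
  convert hasDerivAt_Bprod N (fun p hp hpN => hflow p hp hpN t ht) using 1
  have hb := hbal t ht
  have hN0 : N ≠ 0 := Nat.one_le_iff_ne_zero.1 hN
  rw [← Finset.sum_neg_distrib]
  refine Finset.sum_congr rfl fun k hk => ?_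
  obtain ⟨hk1, hkN⟩ := Finset.mem_Icc.1 hk
  have hleft : Bprod (fun q => W q t) N * (Bprod (fun q => W q t) N)ᵀ
      = (W N t * (W N t)ᵀ) ^ N := by
    rw [Bprod_eq_Aprod_one, hb.Aprod_mul_transpose le_rfl (by omega), Nat.add_sub_cancel]
  have hPL : (W N t * (W N t)ᵀ).PosSemidef := by
    simpa using Matrix.posSemidef_self_mul_conjTranspose (W N t)
  have hPR : ((W 1 t)ᵀ * W 1 t).PosSemidef := by
    simpa using Matrix.posSemidef_conjTranspose_mul_self (W 1 t)
  rw [hleft, hb.transpose_mul_Bprod le_rfl, ← Nat.cast_sub hkN, ← Nat.cast_pred hk1,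
    mpow_pow_div hPL hN0, mpow_pow_div hPR hN0, ← hb.transpose_mul_Bprod (p := k - 1) (by omega),
    show N - k = N + 1 - (k + 1) by omega,
    ← hb.Aprod_mul_transpose (p := k + 1) (by omega) (by omega)]
  simp only [Matrix.mul_neg, Matrix.neg_mul, Matrix.mul_assoc]
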